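/- arXiv:math/0610197 — 3 statements merged into one kernel-verified Lean document; each statement's English description precedes it below -/
import Mathlib

section
/- There exists a constant C > 0 such that for all positive integers ℓ_A and ℓ_B, |P(ℓ_A, ℓ_B) − (2/π) arctan(ℓ_B/ℓ_A)| ≤ C/(ℓ_A² + ℓ_B²); i.e. (2/π) arctan(ℓ_B/ℓ_A) approximates P uniformly in the ratio ℓ_B/ℓ_A. -/
open MeasureTheory Real

/-- Modified Bessel function of the first kind, integer order, defined by its series. -/
noncomputable def besselI (n : ℕ) (x : ℝ) : ℝ :=
  ∑' m : ℕ, (x / 2) ^ (n + 2 * m) / ((m.factorial : ℝ) * ((n + m).factorial : ℝ))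

/-- Probability that walker `A` first reaches site `a` before walker `B` first reaches `b`. -/
noncomputable def Pfirst (a b : ℕ) : ℝ :=
  (a : ℝ) * (b : ℝ) * ∫ tA in Set.Ioi (0 : ℝ),
    (Real.exp (-tA) * besselI a tA / tA) *
      ∫ tB in Set.Ioi tA, Real.exp (-tB) * besselI b tB / tB

open Filter Topology

/-- The entire function `y ↦ ∑ yᵐ / (m! (n+m)!)`, so that `I_n(x) = (x/2)ⁿ besselCore n (x²/4)`. -/
noncomputable def besselCore (n : ℕ) (y : ℝ) : ℝ :=
  ∑' m : ℕ, y ^ m / ((m.factorial : ℝ) * ((n + m).factorial : ℝ))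

lemma norm_besselCore_term_le {y R : ℝ} (hy : |y| ≤ R) (n m : ℕ) :
    ‖y ^ m / ((m.factorial : ℝ) * ((n + m).factorial : ℝ))‖ ≤ R ^ m / (m.factorial : ℝ) := by
  have hm : (0 : ℝ) < m.factorial := by exact_mod_cast m.factorial_pos
  have hnm : (1 : ℝ) ≤ (n + m).factorial := by exact_mod_cast (n + m).factorial_pos
  rw [norm_div, norm_pow, Real.norm_eq_abs, Real.norm_eq_abs,
    abs_of_pos (by positivity : 0 < (m.factorial : ℝ) * ((n + m).factorial : ℝ))]
  have hR : 0 ≤ R := (abs_nonneg y).trans hy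
  gcongr
  nlinarith

lemma summable_besselCore (n : ℕ) (y : ℝ) :
    Summable fun m : ℕ => y ^ m / ((m.factorial : ℝ) * ((n + m).factorial : ℝ)) :=
  Summable.of_norm_bounded (Real.summable_pow_div_factorial |y|)
    (norm_besselCore_term_le le_rfl n)

lemma besselI_eq (n : ℕ) (x : ℝ) :
    besselI n x = (x / 2) ^ n * besselCore n ((x / 2) ^ 2) := by
  rw [besselI, besselCore, ← tsum_mul_left]
  refine tsum_congr fun m => ?_
  rw [pow_add, pow_mul, mul_div_assoc]

lemma hasDerivAt_besselCore_term (n m : ℕ) (y : ℝ) :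
    HasDerivAt (fun z : ℝ => z ^ (m + 1) / (((m + 1).factorial : ℝ) * ((n + (m + 1)).factorial : ℝ)))
      (y ^ m / ((m.factorial : ℝ) * ((n + 1 + m).factorial : ℝ))) y := by
  have hm : (m.factorial : ℝ) ≠ 0 := by exact_mod_cast m.factorial_ne_zero
  have hnm : ((n + 1 + m).factorial : ℝ) ≠ 0 := by exact_mod_cast (n + 1 + m).factorial_ne_zero
  have h := (hasDerivAt_pow (m + 1) y).div_const
    (((m + 1).factorial : ℝ) * ((n + (m + 1)).factorial : ℝ))
  refine h.congr_deriv ?_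
  rw [show n + (m + 1) = n + 1 + m by ring, Nat.factorial_succ]
  push_cast
  have : (m : ℝ) + 1 ≠ 0 := by positivity
  field_simp

lemma hasDerivAt_besselCore (n : ℕ) (y : ℝ) :
    HasDerivAt (besselCore n) (besselCore (n + 1) y) y := by
  have hsplit : besselCore n = fun z => 1 / ((Nat.factorial 0 : ℝ) * ((n + 0).factorial : ℝ)) +
      ∑' m : ℕ, z ^ (m + 1) / (((m + 1).factorial : ℝ) * ((n + (m + 1)).factorial : ℝ)) := by
    funext z
    rw [besselCore, (summable_besselCore n z).tsum_eq_zero_add, pow_zero]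
  rw [hsplit]
  refine HasDerivAt.const_add _ ?_
  refine hasDerivAt_tsum_of_isPreconnected
    (u := fun m => (|y| + 1) ^ m / (m.factorial : ℝ)) (t := Metric.ball 0 (|y| + 1))
    (g := fun m z => z ^ (m + 1) / (((m + 1).factorial : ℝ) * ((n + (m + 1)).factorial : ℝ)))
    (g' := fun m z => z ^ m / ((m.factorial : ℝ) * ((n + 1 + m).factorial : ℝ)))
    (y₀ := 0) (Real.summable_pow_div_factorial _) Metric.isOpen_ball
    (convex_ball _ _).isPreconnected (fun m z _ => hasDerivAt_besselCore_term n m z)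
    (fun m z hz => ?_) (by simpa using by positivity) ?_ (by simp)
  · have hz' : |z| < |y| + 1 := by simpa using hz
    exact norm_besselCore_term_le hz'.le (n + 1) m
  · exact (summable_nat_add_iff 1).2 (summable_besselCore n 0)

lemma besselCore_recurrence (n : ℕ) (y : ℝ) :
    besselCore n y = (n + 1) * besselCore (n + 1) y + y * besselCore (n + 2) y := by
  have h0 := summable_besselCore n y
  have h1 := summable_besselCore (n + 1) y
  have h2 := summable_besselCore (n + 2) y
  have e1 : besselCore (n + 1) y = 1 / ((n + 1).factorial : ℝ) + ∑' m : ℕ,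
      y ^ (m + 1) / (((m + 1).factorial : ℝ) * ((n + 1 + (m + 1)).factorial : ℝ)) := by
    rw [besselCore, h1.tsum_eq_zero_add]; simp
  have e0 : besselCore n y = 1 / (n.factorial : ℝ) + ∑' m : ℕ,
      y ^ (m + 1) / (((m + 1).factorial : ℝ) * ((n + (m + 1)).factorial : ℝ)) := by
    rw [besselCore, h0.tsum_eq_zero_add]; simp
  rw [e0, e1, besselCore, mul_add, ← tsum_mul_left, ← tsum_mul_left, add_assoc,
    ← (((summable_nat_add_iff 1).2 h1).mul_left _).tsum_add (h2.mul_left _)]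
  congr 1
  · rw [Nat.factorial_succ]
    have : (n.factorial : ℝ) ≠ 0 := by exact_mod_cast n.factorial_ne_zero
    push_cast
    field_simp
  · refine tsum_congr fun m => ?_
    have hm : (m.factorial : ℝ) ≠ 0 := by exact_mod_cast m.factorial_ne_zero
    have hnm : ((n + 1 + m).factorial : ℝ) ≠ 0 := by exact_mod_cast (n + 1 + m).factorial_ne_zero
    rw [show n + 1 + (m + 1) = (n + 1 + m) + 1 by ring, show n + 2 + m = (n + 1 + m) + 1 by ring,
      show n + (m + 1) = n + 1 + m by ring, Nat.factorial_succ m, Nat.factorial_succ (n + 1 + m)]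
    have h3 : (m : ℝ) + 1 ≠ 0 := by positivity
    have h4 : (n : ℝ) + 1 + m + 1 ≠ 0 := by positivity
    push_cast
    field_simp
    ring

lemma besselI_recurrence (n : ℕ) (x : ℝ) :
    x * (besselI n x - besselI (n + 2) x) = 2 * (n + 1) * besselI (n + 1) x := by
  rw [besselI_eq, besselI_eq, besselI_eq, besselCore_recurrence n]
  ring

lemma hasDerivAt_besselI (n : ℕ) (x : ℝ) :
    HasDerivAt (besselI n) ((n * (x / 2) ^ (n - 1) * besselCore n ((x / 2) ^ 2)) / 2
      + besselI (n + 1) x) x := by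
  have hu : HasDerivAt (fun x : ℝ => x / 2) (1 / 2) x := (hasDerivAt_id x).div_const 2
  have h := (hu.pow n).mul
    (HasDerivAt.comp x (hasDerivAt_besselCore n ((x / 2) ^ 2)) (hu.pow 2))
  have heq : besselI n = fun x => (x / 2) ^ n * besselCore n ((x / 2) ^ 2) :=
    funext (besselI_eq n)
  rw [heq]
  refine h.congr_deriv ?_
  rw [besselI_eq (n + 1)]
  simp
  ring

lemma hasDerivAt_besselI_zero (x : ℝ) : HasDerivAt (besselI 0) (besselI 1 x) x := by
  simpa using hasDerivAt_besselI 0 x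

lemma hasDerivAt_besselI_succ (n : ℕ) (x : ℝ) :
    HasDerivAt (besselI (n + 1)) ((besselI n x + besselI (n + 2) x) / 2) x := by
  refine (hasDerivAt_besselI (n + 1) x).congr_deriv ?_
  rw [besselI_eq, besselI_eq, besselCore_recurrence n]
  simp
  ring

lemma besselI_nonneg (n : ℕ) {x : ℝ} (hx : 0 ≤ x) : 0 ≤ besselI n x :=
  tsum_nonneg fun _ => by positivity

lemma besselI_zero_right (n : ℕ) : besselI n 0 = if n = 0 then 1 else 0 := by
  have h0 : besselCore 0 0 = 1 := by
    rw [besselCore, tsum_eq_single 0 (fun m hm => by simp [hm])]; simp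
  rw [besselI_eq]
  split_ifs with h
  · subst h; simp [h0]
  · simp [h]

/-- Probability that the continuous-time walk started at `0` sits at site `n` at time `t`. -/
noncomputable def walkProb (n : ℕ) (t : ℝ) : ℝ := Real.exp (-t) * besselI n t

/-- Density of the first-passage time to site `n`. -/
noncomputable def passageDensity : ℕ → ℝ → ℝ
  | 0, _ => 0
  | n + 1, t => (walkProb n t - walkProb (n + 2) t) / 2

/-- Probability that site `n` has not been reached by time `t`. -/
noncomputable def survival (n : ℕ) (t : ℝ) : ℝ :=
  ∑ k ∈ Finset.range n, (walkProb k t + walkProb (k + 1) t)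

lemma walkProb_nonneg (n : ℕ) {t : ℝ} (ht : 0 ≤ t) : 0 ≤ walkProb n t :=
  mul_nonneg (Real.exp_pos _).le (besselI_nonneg n ht)

lemma walkProb_zero_right (n : ℕ) : walkProb n 0 = if n = 0 then 1 else 0 := by
  simp [walkProb, besselI_zero_right]

lemma hasDerivAt_walkProb_zero (t : ℝ) :
    HasDerivAt (walkProb 0) (walkProb 1 t - walkProb 0 t) t := by
  refine (((hasDerivAt_neg t).exp).mul (hasDerivAt_besselI_zero t)).congr_deriv ?_
  simp only [walkProb]
  ring

lemma hasDerivAt_walkProb_succ (n : ℕ) (t : ℝ) :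
    HasDerivAt (walkProb (n + 1))
      ((walkProb n t + walkProb (n + 2) t) / 2 - walkProb (n + 1) t) t := by
  refine (((hasDerivAt_neg t).exp).mul (hasDerivAt_besselI_succ n t)).congr_deriv ?_
  simp only [walkProb]
  ring

lemma passageDensity_eq (n : ℕ) {t : ℝ} (ht : t ≠ 0) :
    passageDensity n t = n * (Real.exp (-t) * besselI n t / t) := by
  cases n with
  | zero => simp [passageDensity]
  | succ n =>
    have h := besselI_recurrence n t
    simp only [passageDensity, walkProb]
    rw [mul_div_assoc', div_eq_div_iff two_ne_zero ht]
    push_cast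
    linear_combination Real.exp (-t) * h

lemma passageDensity_nonneg (n : ℕ) {t : ℝ} (ht : 0 < t) : 0 ≤ passageDensity n t := by
  rw [passageDensity_eq n ht.ne']
  have := besselI_nonneg n ht.le
  positivity

lemma hasDerivAt_passageDensity (n : ℕ) (t : ℝ) :
    HasDerivAt (passageDensity (n + 1))
      ((passageDensity n t + passageDensity (n + 2) t) / 2 - passageDensity (n + 1) t) t := by
  cases n with
  | zero =>
    refine (((hasDerivAt_walkProb_zero t).sub
      (hasDerivAt_walkProb_succ 1 t)).div_const 2).congr_deriv ?_
    simp only [passageDensity]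
    ring
  | succ n =>
    refine (((hasDerivAt_walkProb_succ n t).sub
      (hasDerivAt_walkProb_succ (n + 2) t)).div_const 2).congr_deriv ?_
    simp only [passageDensity]
    ring

lemma hasDerivAt_survival (n : ℕ) (t : ℝ) :
    HasDerivAt (survival n) (-passageDensity n t) t := by
  induction n with
  | zero =>
    have heq : survival 0 = fun _ => 0 := by
      funext s
      simp [survival]
    rw [heq]
    exact (hasDerivAt_const t (0 : ℝ)).congr_deriv (by simp [passageDensity])
  | succ n ih =>
    have heq : survival (n + 1) = survival n + (walkProb n + walkProb (n + 1)) := by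
      funext s
      simp [survival, Finset.sum_range_succ]
    rw [heq]
    cases n with
    | zero =>
      refine (ih.add ((hasDerivAt_walkProb_zero t).add
        (hasDerivAt_walkProb_succ 0 t))).congr_deriv ?_
      simp only [passageDensity]
      ring
    | succ n =>
      refine (ih.add ((hasDerivAt_walkProb_succ n t).add
        (hasDerivAt_walkProb_succ (n + 1) t))).congr_deriv ?_
      simp only [passageDensity]
      ring

lemma survival_second_difference (n : ℕ) (t : ℝ) :
    (survival n t + survival (n + 2) t) / 2 - survival (n + 1) t = -passageDensity (n + 1) t := by
  simp only [survival, Finset.sum_range_succ, passageDensity]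
  ring

lemma survival_zero_right (n : ℕ) : survival (n + 1) 0 = 1 := by
  simp only [survival, walkProb_zero_right]
  rw [Finset.sum_range_succ']
  simp

lemma survival_nonneg (n : ℕ) {t : ℝ} (ht : 0 ≤ t) : 0 ≤ survival n t :=
  Finset.sum_nonneg fun _ _ => add_nonneg (walkProb_nonneg _ ht) (walkProb_nonneg _ ht)

lemma survival_le_one (n : ℕ) {t : ℝ} (ht : 0 ≤ t) : survival n t ≤ 1 := by
  cases n with
  | zero => simp [survival]
  | succ n =>
    rw [← survival_zero_right n]
    refine antitoneOn_of_deriv_nonpos (convex_Ici 0)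
      (fun s _ => (hasDerivAt_survival (n + 1) s).continuousAt.continuousWithinAt)
      (fun s _ => (hasDerivAt_survival (n + 1) s).differentiableAt.differentiableWithinAt)
      (fun s hs => ?_) Set.self_mem_Ici ht ht
    rw [interior_Ici] at hs
    rw [(hasDerivAt_survival (n + 1) s).deriv]
    exact neg_nonpos.2 (passageDensity_nonneg _ hs)

lemma walkProb_add_two_le (n : ℕ) {t : ℝ} (ht : 0 < t) : walkProb (n + 2) t ≤ walkProb n t := by
  have := passageDensity_nonneg (n + 1) ht
  simp only [passageDensity] at this
  linarith

lemma walkProb_le_one (n : ℕ) {t : ℝ} (ht : 0 ≤ t) : walkProb n t ≤ 1 := by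
  refine le_trans ?_ (survival_le_one (n + 1) ht)
  rw [survival, Finset.sum_range_succ]
  have h1 := survival_nonneg n ht
  have h2 := walkProb_nonneg (n + 1) ht
  rw [survival] at h1
  linarith

lemma tendsto_passageDensity (n : ℕ) : Tendsto (passageDensity n) atTop (𝓝 0) := by
  refine squeeze_zero' (g := fun t : ℝ => n / t) ?_ ?_ (tendsto_const_nhds.div_atTop tendsto_id)
  · filter_upwards [eventually_gt_atTop 0] with t ht using passageDensity_nonneg n ht
  · filter_upwards [eventually_gt_atTop 0] with t ht
    rw [passageDensity_eq n ht.ne', mul_div_assoc']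
    gcongr
    exact mul_le_of_le_one_right n.cast_nonneg (walkProb_le_one n ht.le)

lemma walkProb_sub_add_two_mul (n k : ℕ) (t : ℝ) :
    walkProb n t - walkProb (n + 2 * k) t
      = 2 * ∑ j ∈ Finset.range k, passageDensity (n + 2 * j + 1) t := by
  induction k with
  | zero => simp
  | succ k ih =>
    rw [show n + 2 * (k + 1) = n + 2 * k + 2 by ring, Finset.sum_range_succ, mul_add, ← ih]
    simp only [passageDensity]
    ring

lemma mul_walkProb_le_one (n k : ℕ) {t : ℝ} (ht : 0 < t) : k * walkProb (n + 2 * k) t ≤ 1 := by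
  refine le_trans ?_ (survival_le_one (n + 2 * k) ht.le)
  have hmono : ∀ j ≤ k, walkProb (n + 2 * k) t ≤ walkProb (n + 2 * j) t := by
    intro j hj
    induction k, hj using Nat.le_induction with
    | base => exact le_rfl
    | succ k _ ih => exact (walkProb_add_two_le (n + 2 * k) ht).trans ih
  have hsum : ∀ j ≤ k, j * walkProb (n + 2 * k) t ≤ survival (n + 2 * j) t := by
    intro j hj
    induction j with
    | zero => simpa using survival_nonneg n ht.le
    | succ j ih =>
      have h1 := ih (by omega)
      have h2 := hmono j (by omega)
      have h3 := walkProb_nonneg (n + 2 * j + 1) ht.le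
      have h4 := walkProb_nonneg (n + 2 * j + 2) ht.le
      rw [survival] at h1
      rw [survival, show n + 2 * (j + 1) = n + 2 * j + 1 + 1 by ring, Finset.sum_range_succ,
        Finset.sum_range_succ]
      push_cast
      linarith
  exact hsum k le_rfl

lemma tendsto_walkProb (n : ℕ) : Tendsto (walkProb n) atTop (𝓝 0) := by
  rw [Metric.tendsto_atTop']
  intro ε hε
  obtain ⟨k, hk⟩ := exists_nat_gt (2 / ε)
  have hk0 : (0 : ℝ) < k := lt_trans (by positivity) hk
  have hdiff : Tendsto (fun t => walkProb n t - walkProb (n + 2 * k) t) atTop (𝓝 0) := by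
    simp_rw [walkProb_sub_add_two_mul]
    simpa using (tendsto_finsetSum (Finset.range k)
      fun j _ => tendsto_passageDensity (n + 2 * j + 1)).const_mul 2
  obtain ⟨N, hN⟩ := (Metric.tendsto_atTop'.1 hdiff) (ε / 2) (by positivity)
  refine ⟨max N 0, fun t ht => ?_⟩
  have ht0 : 0 < t := (le_max_right _ _).trans_lt ht
  have h1 := hN t ((le_max_left _ _).trans_lt ht)
  have h2 := mul_walkProb_le_one n k ht0
  rw [Real.dist_eq, sub_zero] at h1 ⊢
  rw [abs_of_nonneg (walkProb_nonneg n ht0.le)]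
  have h3 : walkProb (n + 2 * k) t < ε / 2 := by
    rw [div_lt_iff₀ hε] at hk
    by_contra! h
    nlinarith
  linarith [le_abs_self (walkProb n t - walkProb (n + 2 * k) t)]

lemma tendsto_survival (n : ℕ) : Tendsto (survival n) atTop (𝓝 0) := by
  have h : Tendsto (survival n) atTop (𝓝 (∑ k ∈ Finset.range n, (0 + 0 : ℝ))) :=
    tendsto_finsetSum _ fun k _ => (tendsto_walkProb k).add (tendsto_walkProb (k + 1))
  rwa [add_zero, Finset.sum_const_zero] at h

lemma integrableOn_passageDensity (n : ℕ) {s : ℝ} (hs : 0 ≤ s) :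
    IntegrableOn (passageDensity n) (Set.Ioi s) := by
  have h := integrableOn_Ioi_deriv_of_nonpos' (a := s) (fun t _ => hasDerivAt_survival n t)
    (fun t ht => neg_nonpos.2 (passageDensity_nonneg n (hs.trans_lt ht))) (tendsto_survival n)
  simpa using h.neg

lemma integral_passageDensity (n : ℕ) {s : ℝ} (hs : 0 ≤ s) :
    ∫ t in Set.Ioi s, passageDensity n t = survival n s := by
  have h := integral_Ioi_of_hasDerivAt_of_tendsto' (a := s)
    (fun t _ => hasDerivAt_survival n t) (integrableOn_passageDensity n hs).neg (tendsto_survival n)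
  rw [integral_neg] at h
  linarith

lemma continuous_survival (n : ℕ) : Continuous (survival n) :=
  continuous_iff_continuousAt.2 fun t => (hasDerivAt_survival n t).continuousAt

lemma integrableOn_passageDensity_mul_survival (a b : ℕ) :
    IntegrableOn (fun t => passageDensity a t * survival b t) (Set.Ioi 0) := by
  refine Integrable.mul_bdd (c := 1) (integrableOn_passageDensity a le_rfl)
    (continuous_survival b).aestronglyMeasurable ?_
  filter_upwards [ae_restrict_mem measurableSet_Ioi] with t ht
  rw [Real.norm_eq_abs, abs_of_nonneg (survival_nonneg b (le_of_lt ht))]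
  exact survival_le_one b (le_of_lt ht)

lemma Pfirst_eq (a b : ℕ) :
    Pfirst a b = ∫ t in Set.Ioi (0 : ℝ), passageDensity a t * survival b t := by
  rw [Pfirst, ← integral_const_mul]
  refine setIntegral_congr_fun measurableSet_Ioi fun t ht => ?_
  have ht0 : 0 < t := ht
  have hinner : survival b t = b * ∫ s in Set.Ioi t, Real.exp (-s) * besselI b s / s := by
    rw [← integral_passageDensity b ht0.le, ← integral_const_mul]
    exact setIntegral_congr_fun measurableSet_Ioi fun s hs =>
      passageDensity_eq b (ht0.trans hs).ne'
  rw [passageDensity_eq a ht0.ne', hinner]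
  ring

lemma Pfirst_zero_right (a : ℕ) : Pfirst a 0 = 0 := by simp [Pfirst]

lemma Pfirst_nonneg (a b : ℕ) : 0 ≤ Pfirst a b := by
  rw [Pfirst_eq]
  exact setIntegral_nonneg measurableSet_Ioi fun t ht =>
    mul_nonneg (passageDensity_nonneg a ht) (survival_nonneg b (le_of_lt ht))

lemma Pfirst_le_one (a b : ℕ) : Pfirst a b ≤ 1 := by
  rw [Pfirst_eq]
  refine le_trans ?_ (survival_le_one a le_rfl)
  rw [← integral_passageDensity a le_rfl]
  exact setIntegral_mono_on (integrableOn_passageDensity_mul_survival a b)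
    (integrableOn_passageDensity a le_rfl) measurableSet_Ioi fun t ht =>
      mul_le_of_le_one_right (passageDensity_nonneg a ht) (survival_le_one b (le_of_lt ht))

lemma Pfirst_add_swap (a b : ℕ) : Pfirst (a + 1) (b + 1) + Pfirst (b + 1) (a + 1) = 1 := by
  have hderiv : ∀ t ∈ Set.Ici (0 : ℝ), HasDerivAt (survival (a + 1) * survival (b + 1))
      (-(passageDensity (a + 1) t * survival (b + 1) t
        + passageDensity (b + 1) t * survival (a + 1) t)) t := fun t _ =>
    ((hasDerivAt_survival (a + 1) t).mul (hasDerivAt_survival (b + 1) t)).congr_deriv (by ring)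
  have h1 := integrableOn_passageDensity_mul_survival (a + 1) (b + 1)
  have h2 := integrableOn_passageDensity_mul_survival (b + 1) (a + 1)
  have h := integral_Ioi_of_hasDerivAt_of_tendsto' hderiv (h1.add h2).neg
    ((tendsto_survival (a + 1)).mul (tendsto_survival (b + 1)))
  rw [integral_neg, integral_add h1 h2, ← Pfirst_eq, ← Pfirst_eq, Pi.mul_apply,
    survival_zero_right, survival_zero_right] at h
  linarith

lemma Pfirst_harmonic (a b : ℕ) :
    Pfirst (a + 3) (b + 1) + Pfirst (a + 1) (b + 1) + Pfirst (a + 2) (b + 2) + Pfirst (a + 2) b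
      = 4 * Pfirst (a + 2) (b + 1) := by
  have hderiv : ∀ t ∈ Set.Ici (0 : ℝ),
      HasDerivAt (passageDensity (a + 2) * survival (b + 1))
        ((passageDensity (a + 3) t * survival (b + 1) t
          + passageDensity (a + 1) t * survival (b + 1) t
          + passageDensity (a + 2) t * survival (b + 2) t
          + passageDensity (a + 2) t * survival b t
          - 4 * (passageDensity (a + 2) t * survival (b + 1) t)) / 2) t := fun t _ =>
    ((hasDerivAt_passageDensity (a + 1) t).mul (hasDerivAt_survival (b + 1) t)).congr_deriv (by
      rw [← survival_second_difference]
      ring)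
  have h1 := integrableOn_passageDensity_mul_survival (a + 3) (b + 1)
  have h2 := integrableOn_passageDensity_mul_survival (a + 1) (b + 1)
  have h3 := integrableOn_passageDensity_mul_survival (a + 2) (b + 2)
  have h4 := integrableOn_passageDensity_mul_survival (a + 2) b
  have h5 := (integrableOn_passageDensity_mul_survival (a + 2) (b + 1)).const_mul 4
  have h12 : IntegrableOn (fun t => passageDensity (a + 3) t * survival (b + 1) t
    + passageDensity (a + 1) t * survival (b + 1) t) (Set.Ioi 0) := h1.add h2
  have h123 : IntegrableOn (fun t => passageDensity (a + 3) t * survival (b + 1) t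
    + passageDensity (a + 1) t * survival (b + 1) t
    + passageDensity (a + 2) t * survival (b + 2) t) (Set.Ioi 0) := h12.add h3
  have h1234 : IntegrableOn (fun t => passageDensity (a + 3) t * survival (b + 1) t
    + passageDensity (a + 1) t * survival (b + 1) t
    + passageDensity (a + 2) t * survival (b + 2) t
    + passageDensity (a + 2) t * survival b t) (Set.Ioi 0) := h123.add h4
  have h := integral_Ioi_of_hasDerivAt_of_tendsto' hderiv
    ((h1234.sub h5).div_const 2)
    ((tendsto_passageDensity (a + 2)).mul (tendsto_survival (b + 1)))
  rw [integral_div, integral_sub h1234 h5, integral_add h123 h4,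
    integral_add h12 h3, integral_add h1 h2,
    integral_const_mul] at h
  simp only [← Pfirst_eq] at h
  have h0 : passageDensity (a + 2) 0 = 0 := by
    simp [passageDensity, walkProb_zero_right]
  rw [Pi.mul_apply, h0] at h
  linarith

/-- Minimum principle for bounded discrete superharmonic functions on the wedge `0 ≤ b ≤ a`. -/
lemma nonneg_of_superharmonic_on_wedge {g : ℕ → ℕ → ℝ} {M : ℝ}
    (hM : ∀ a b, b ≤ a → -M ≤ g a b) (hzero : ∀ a, 0 ≤ g a 0) (hdiag : ∀ a, 0 ≤ g a a)
    (hsuper : ∀ a b, b ≤ a → g (a + 3) (b + 1) + g (a + 1) (b + 1) + g (a + 2) (b + 2)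
      + g (a + 2) b ≤ 4 * g (a + 2) (b + 1)) {a b : ℕ} (hab : b ≤ a) : 0 ≤ g a b := by
  suffices h : ∀ ε : ℝ, 0 < ε → 0 ≤ g a b + ε * (a * b) by
    refine le_of_forall_pos_le_add fun δ hδ => ?_
    have hpos : (0 : ℝ) < a * b + 1 := by positivity
    refine (h (δ / (a * b + 1)) (by positivity)).trans (add_le_add_right ?_ _)
    rw [div_mul_eq_mul_div, div_le_iff₀ hpos]
    nlinarith
  intro ε hε
  obtain ⟨N, hN⟩ := exists_nat_gt (M / ε)
  rw [div_lt_iff₀ hε] at hN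
  set S : Finset (ℕ × ℕ) :=
    (Finset.range (max N a + 1) ×ˢ Finset.range (max N a + 1)).filter fun p => p.2 ≤ p.1 with hS
  have hmem : ∀ x y : ℕ, (x, y) ∈ S ↔ y ≤ x ∧ x ≤ max N a := fun x y => by
    simp only [hS, Finset.mem_filter, Finset.mem_product, Finset.mem_range]
    omega
  set h : ℕ × ℕ → ℝ := fun p => g p.1 p.2 + ε * (p.1 * p.2) with hh
  have hmemab : (a, b) ∈ S := (hmem a b).2 ⟨hab, le_max_right _ _⟩
  obtain ⟨⟨x, y⟩, hxy, hmin⟩ := S.exists_min_image (fun p => toLex (h p, -(p.1 : ℤ))) ⟨_, hmemab⟩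
  simp only [Prod.Lex.toLex_le_toLex] at hmin
  have hle : ∀ p ∈ S, h (x, y) ≤ h p := fun p hp => by
    rcases hmin p hp with h1 | h1
    exacts [h1.le, h1.1.le]
  refine le_trans ?_ (hle _ hmemab)
  obtain ⟨hyx, hxN⟩ := (hmem x y).1 hxy
  rcases Nat.eq_zero_or_pos y with rfl | hy
  · simpa [hh] using hzero x
  rcases hyx.eq_or_lt with rfl | hlt
  · have := hdiag y
    simp only [hh]
    positivity
  rcases hxN.eq_or_lt with hxe | hxlt
  · have h1 := hM x y hyx
    have h2 : (N : ℝ) ≤ x := by exact_mod_cast hxe ▸ le_max_left N a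
    have h3 : (1 : ℝ) ≤ y := by exact_mod_cast hy
    have h4 : (N : ℝ) ≤ x * y := by nlinarith [(Nat.cast_nonneg N : (0 : ℝ) ≤ N)]
    simp only [hh]
    nlinarith
  · exfalso
    obtain ⟨y, rfl⟩ : ∃ k, y = k + 1 := ⟨y - 1, by omega⟩
    obtain ⟨x, rfl⟩ : ∃ k, x = k + 2 := ⟨x - 2, by omega⟩
    have h1 : h (x + 2, y + 1) < h (x + 3, y + 1) := by
      rcases hmin (x + 3, y + 1) ((hmem _ _).2 ⟨by omega, by omega⟩) with h1 | h1
      · exact h1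
      · have := h1.2
        push_cast at this
        omega
    have h2 := hle (x + 1, y + 1) ((hmem _ _).2 ⟨by omega, by omega⟩)
    have h3 := hle (x + 2, y + 2) ((hmem _ _).2 ⟨by omega, by omega⟩)
    have h4 := hle (x + 2, y) ((hmem _ _).2 ⟨by omega, by omega⟩)
    have h5 := hsuper x y (by omega)
    simp only [hh] at h1 h2 h3 h4
    push_cast at h1 h2 h3 h4
    nlinarith

lemma arctan_div_sub_arctan_div {x₁ y₁ x₂ y₂ : ℝ} (h₁ : 0 < x₁) (h₂ : 0 < x₂)
    (h : 0 < x₁ * x₂ + y₁ * y₂) :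
    arctan (y₁ / x₁) - arctan (y₂ / x₂) = arctan ((y₁ * x₂ - y₂ * x₁) / (x₁ * x₂ + y₁ * y₂)) := by
  have hlt : y₁ / x₁ * (-(y₂ / x₂)) < 1 := by
    have : 1 - y₁ / x₁ * (-(y₂ / x₂)) = (x₁ * x₂ + y₁ * y₂) / (x₁ * x₂) := by field_simp; ring
    have : 0 < 1 - y₁ / x₁ * (-(y₂ / x₂)) := this ▸ by positivity
    linarith
  rw [sub_eq_add_neg, ← arctan_neg, arctan_add hlt]
  congr 1
  have hne : 1 - y₁ / x₁ * (-(y₂ / x₂)) ≠ 0 := by linarith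
  rw [div_eq_div_iff hne h.ne']
  field_simp
  ring

lemma arctan_sub_arctan_le {u v : ℝ} (h : v ≤ u) : arctan u - arctan v ≤ u - v := by
  have := Convex.image_sub_le_mul_sub_of_deriv_le convex_univ (f := arctan) (C := 1)
    continuous_arctan.continuousOn differentiable_arctan.differentiableOn (fun x _ => by
      rw [Real.deriv_arctan, div_le_one (by positivity)]
      nlinarith [sq_nonneg x]) v trivial u trivial h
  linarith

lemma arctan_discrete_laplacian {x y : ℝ} (hy : 1 ≤ y) (hxy : y + 1 ≤ x) :
    arctan (y / (x + 1)) + arctan (y / (x - 1)) + arctan ((y + 1) / x) + arctan ((y - 1) / x)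
        - 4 * arctan (y / x)
      = arctan (2 * x * y / ((x ^ 2 + y ^ 2) ^ 2 - x ^ 2 + y ^ 2))
        - arctan (2 * x * y / ((x ^ 2 + y ^ 2) ^ 2 + x ^ 2 - y ^ 2)) := by
  have hx : 0 < x := by linarith
  have e1 := arctan_div_sub_arctan_div (x₁ := x - 1) (y₁ := y) (x₂ := x) (y₂ := y)
    (by linarith) hx (by nlinarith)
  have e2 := arctan_div_sub_arctan_div (x₁ := x) (y₁ := y) (x₂ := x + 1) (y₂ := y)
    hx (by linarith) (by nlinarith)
  have e3 := arctan_div_sub_arctan_div (x₁ := x) (y₁ := y) (x₂ := x) (y₂ := y - 1)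
    hx hx (by nlinarith)
  have e4 := arctan_div_sub_arctan_div (x₁ := x) (y₁ := y + 1) (x₂ := x) (y₂ := y)
    hx hx (by nlinarith)
  have hx2 : 0 < (x - 1) * x + y * y := by nlinarith
  have hy2 : 0 < x * x + y * (y - 1) := by nlinarith
  have e12 := arctan_div_sub_arctan_div (x₁ := (x - 1) * x + y * y) (y₁ := y * x - y * (x - 1))
    (x₂ := x * (x + 1) + y * y) (y₂ := y * (x + 1) - y * x) hx2 (by nlinarith)
    (by
      have h1 : 0 < x * (x + 1) + y * y := by nlinarith
      have h2 : 0 < (y * x - y * (x - 1)) * (y * (x + 1) - y * x) := by ring_nf; positivity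
      have := mul_pos hx2 h1
      linarith)
  have e34 := arctan_div_sub_arctan_div (x₁ := x * x + y * (y - 1)) (y₁ := y * x - (y - 1) * x)
    (x₂ := x * x + (y + 1) * y) (y₂ := (y + 1) * x - y * x) hy2 (by nlinarith)
    (by
      have h1 : 0 < x * x + (y + 1) * y := by nlinarith
      have h2 : 0 < (y * x - (y - 1) * x) * ((y + 1) * x - y * x) := by ring_nf; positivity
      have := mul_pos hy2 h1
      linarith)
  rw [← e1, ← e2] at e12
  rw [← e3, ← e4] at e34
  have t1 : ((y * x - y * (x - 1)) * (x * (x + 1) + y * y)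
      - (y * (x + 1) - y * x) * ((x - 1) * x + y * y)) / (((x - 1) * x + y * y)
      * (x * (x + 1) + y * y) + (y * x - y * (x - 1)) * (y * (x + 1) - y * x))
      = 2 * x * y / ((x ^ 2 + y ^ 2) ^ 2 - x ^ 2 + y ^ 2) := by
    congr 1 <;> ring
  have t2 : ((y * x - (y - 1) * x) * (x * x + (y + 1) * y)
      - ((y + 1) * x - y * x) * (x * x + y * (y - 1))) / ((x * x + y * (y - 1))
      * (x * x + (y + 1) * y) + (y * x - (y - 1) * x) * ((y + 1) * x - y * x))
      = 2 * x * y / ((x ^ 2 + y ^ 2) ^ 2 + x ^ 2 - y ^ 2) := by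
    congr 1 <;> ring
  rw [t1] at e12
  rw [t2] at e34
  linarith

lemma arctan_discrete_laplacian_bounds {x y : ℝ} (hy : 1 ≤ y) (hxy : y + 1 ≤ x) :
    0 ≤ arctan (y / (x + 1)) + arctan (y / (x - 1)) + arctan ((y + 1) / x)
        + arctan ((y - 1) / x) - 4 * arctan (y / x) ∧
      arctan (y / (x + 1)) + arctan (y / (x - 1)) + arctan ((y + 1) / x)
        + arctan ((y - 1) / x) - 4 * arctan (y / x) ≤ 4 / (x ^ 2 + y ^ 2) ^ 2 := by
  rw [arctan_discrete_laplacian hy hxy]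
  have hx : 2 ≤ x := by linarith
  obtain ⟨R, hR⟩ : ∃ R, R = x ^ 2 + y ^ 2 := ⟨_, rfl⟩
  obtain ⟨d, hd⟩ : ∃ d, d = x ^ 2 - y ^ 2 := ⟨_, rfl⟩
  have hR5 : 5 ≤ R := by nlinarith
  have hd0 : 0 ≤ d := by nlinarith
  have hdR : d ≤ R := by nlinarith
  have hxyR : 2 * x * y ≤ R := by nlinarith [sq_nonneg (x - y)]
  have hxy0 : 0 < 2 * x * y := by positivity
  rw [show (x ^ 2 + y ^ 2) ^ 2 - x ^ 2 + y ^ 2 = R ^ 2 - d by rw [hR, hd]; ring,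
    show (x ^ 2 + y ^ 2) ^ 2 + x ^ 2 - y ^ 2 = R ^ 2 + d by rw [hR, hd]; ring, ← hR]
  have hm : 0 < R ^ 2 - d := by nlinarith
  have hp : 0 < R ^ 2 + d := by nlinarith
  have hle : 2 * x * y / (R ^ 2 + d) ≤ 2 * x * y / (R ^ 2 - d) := by
    gcongr
    linarith
  refine ⟨sub_nonneg.2 (arctan_mono hle), (arctan_sub_arctan_le hle).trans ?_⟩
  rw [div_sub_div _ _ hm.ne' hp.ne', div_le_div_iff₀ (by positivity) (by positivity)]
  have h1 : 2 * x * y * d ≤ R * R := mul_le_mul hxyR hdR hd0 (by linarith)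
  have h2 : 2 * x * y * d * R ^ 2 ≤ R * R * R ^ 2 := by gcongr
  have h3 : d ^ 2 ≤ R ^ 2 := by gcongr
  nlinarith [sq_nonneg R, mul_nonneg (sq_nonneg R) (by nlinarith : 0 ≤ R ^ 2 - 2)]

/-- A nonnegative function on the wedge `0 ≤ y ≤ x` that vanishes on its boundary and whose
discrete Laplacian is at most `-1 / (x² + y²)²`. -/
noncomputable def wedgeBarrier (x y : ℝ) : ℝ := y * (x - y) / (x ^ 2 + y ^ 2) ^ 2

lemma wedgeBarrier_numerator_le {x y R : ℝ} (hy : 1 ≤ y) (hxy : y + 1 ≤ x)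
    (hR : R = x ^ 2 + y ^ 2) :
    R ^ 2 * (y * (x + 1 - y) * (R + 1 - 2 * x) ^ 2 * (R + 1 + 2 * y) ^ 2 * (R + 1 - 2 * y) ^ 2
      + y * (x - 1 - y) * (R + 1 + 2 * x) ^ 2 * (R + 1 + 2 * y) ^ 2 * (R + 1 - 2 * y) ^ 2
      + (y + 1) * (x - y - 1) * (R + 1 + 2 * x) ^ 2 * (R + 1 - 2 * x) ^ 2 * (R + 1 - 2 * y) ^ 2
      + (y - 1) * (x - y + 1) * (R + 1 + 2 * x) ^ 2 * (R + 1 - 2 * x) ^ 2 * (R + 1 + 2 * y) ^ 2)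
      ≤ (4 * y * (x - y) - 1) * ((R + 1 + 2 * x) ^ 2 * (R + 1 - 2 * x) ^ 2
        * (R + 1 - 2 * y) ^ 2 * (R + 1 + 2 * y) ^ 2) := by
  obtain ⟨v, hv⟩ : ∃ v, v = y - 1 := ⟨_, rfl⟩
  obtain ⟨u, hu⟩ : ∃ u, u = x - y - 1 := ⟨_, rfl⟩
  have hv0 : 0 ≤ v := by linarith
  have hu0 : 0 ≤ u := by linarith
  obtain rfl : y = v + 1 := by linarith
  obtain rfl : x = v + 1 + 1 + u := by linarith
  clear hv hu
  rw [← sub_nonneg]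
  subst hR
  ring_nf
  positivity

lemma wedgeBarrier_discrete_laplacian_le {x y : ℝ} (hy : 1 ≤ y) (hxy : y + 1 ≤ x) :
    wedgeBarrier (x + 1) y + wedgeBarrier (x - 1) y + wedgeBarrier x (y + 1)
      + wedgeBarrier x (y - 1) ≤ 4 * wedgeBarrier x y - 1 / (x ^ 2 + y ^ 2) ^ 2 := by
  obtain ⟨R, hR⟩ : ∃ R, R = x ^ 2 + y ^ 2 := ⟨_, rfl⟩
  have hx : 2 ≤ x := by linarith
  have hR0 : 0 < R := by rw [hR]; positivity
  have h1 : 0 < R + 1 + 2 * x := by linarith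
  have h2 : 0 < R + 1 - 2 * x := by nlinarith
  have h3 : 0 < R + 1 + 2 * y := by linarith
  have h4 : 0 < R + 1 - 2 * y := by nlinarith
  have key := wedgeBarrier_numerator_le hy hxy hR
  simp only [wedgeBarrier]
  rw [show (x + 1) ^ 2 + y ^ 2 = R + 1 + 2 * x by rw [hR]; ring,
    show (x - 1) ^ 2 + y ^ 2 = R + 1 - 2 * x by rw [hR]; ring,
    show x ^ 2 + (y + 1) ^ 2 = R + 1 + 2 * y by rw [hR]; ring,
    show x ^ 2 + (y - 1) ^ 2 = R + 1 - 2 * y by rw [hR]; ring, ← hR]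
  have hsum : y * (x + 1 - y) / (R + 1 + 2 * x) ^ 2 + y * (x - 1 - y) / (R + 1 - 2 * x) ^ 2
      + (y + 1) * (x - (y + 1)) / (R + 1 + 2 * y) ^ 2
      + (y - 1) * (x - (y - 1)) / (R + 1 - 2 * y) ^ 2
      = (y * (x + 1 - y) * (R + 1 - 2 * x) ^ 2 * (R + 1 + 2 * y) ^ 2 * (R + 1 - 2 * y) ^ 2
      + y * (x - 1 - y) * (R + 1 + 2 * x) ^ 2 * (R + 1 + 2 * y) ^ 2 * (R + 1 - 2 * y) ^ 2
      + (y + 1) * (x - y - 1) * (R + 1 + 2 * x) ^ 2 * (R + 1 - 2 * x) ^ 2 * (R + 1 - 2 * y) ^ 2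
      + (y - 1) * (x - y + 1) * (R + 1 + 2 * x) ^ 2 * (R + 1 - 2 * x) ^ 2 * (R + 1 + 2 * y) ^ 2)
      / ((R + 1 + 2 * x) ^ 2 * (R + 1 - 2 * x) ^ 2
        * (R + 1 - 2 * y) ^ 2 * (R + 1 + 2 * y) ^ 2) := by
    generalize R + 1 + 2 * x = A at *
    generalize R + 1 - 2 * x = B at *
    generalize R + 1 + 2 * y = C at *
    generalize R + 1 - 2 * y = D at *
    field_simp
    ring
  rw [hsum, show 4 * (y * (x - y) / R ^ 2) - 1 / R ^ 2 = (4 * y * (x - y) - 1) / R ^ 2 by ring,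
    div_le_div_iff₀ (by positivity) (by positivity)]
  linarith

lemma wedgeBarrier_nonneg {x y : ℝ} (hy : 0 ≤ y) (hxy : y ≤ x) : 0 ≤ wedgeBarrier x y :=
  div_nonneg (mul_nonneg hy (sub_nonneg.2 hxy)) (by positivity)

lemma wedgeBarrier_le (x y : ℝ) : wedgeBarrier x y ≤ 1 / (x ^ 2 + y ^ 2) := by
  rcases eq_or_lt_of_le (by positivity : 0 ≤ x ^ 2 + y ^ 2) with h | h
  · simp [wedgeBarrier, ← h]
  · rw [wedgeBarrier, div_le_div_iff₀ (by positivity) h]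
    nlinarith [sq_nonneg (x - y), sq_nonneg y, sq_nonneg x, sq_nonneg (x + y)]

/-- The difference between `Pfirst` and its continuum approximation. -/
noncomputable def approxError (a b : ℕ) : ℝ := Pfirst a b - 2 / π * arctan (b / a)

lemma approxError_zero_right (a : ℕ) : approxError a 0 = 0 := by
  simp [approxError, Pfirst_zero_right]

lemma approxError_add_swap (a b : ℕ) :
    approxError (a + 1) (b + 1) + approxError (b + 1) (a + 1) = 0 := by
  have h := Pfirst_add_swap a b
  have hinv := arctan_inv_of_pos (x := ((a + 1 : ℕ) : ℝ) / ((b + 1 : ℕ) : ℝ)) (by positivity)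
  rw [inv_div] at hinv
  simp only [approxError]
  rw [hinv]
  have hpi : 2 / π * (π / 2) = 1 := by field_simp
  linear_combination h - hpi

lemma approxError_self (a : ℕ) : approxError a a = 0 := by
  cases a with
  | zero => exact approxError_zero_right 0
  | succ a => linarith [approxError_add_swap a a]

lemma abs_approxError_le (a b : ℕ) : |approxError a b| ≤ 1 := by
  have h0 := Pfirst_nonneg a b
  have h1 := Pfirst_le_one a b
  have h2 : 0 ≤ arctan ((b : ℝ) / a) := arctan_nonneg.2 (by positivity)
  have h3 : 2 / π * arctan ((b : ℝ) / a) ≤ 2 / π * (π / 2) := by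
    gcongr
    exact (arctan_lt_pi_div_two _).le
  have h4 : 2 / π * (π / 2) = 1 := by field_simp
  have h5 : 0 ≤ 2 / π * arctan ((b : ℝ) / a) := by positivity
  rw [approxError, abs_le]
  constructor <;> linarith

lemma approxError_discrete_laplacian_bounds {a b : ℕ} (hab : b ≤ a) :
    approxError (a + 3) (b + 1) + approxError (a + 1) (b + 1) + approxError (a + 2) (b + 2)
        + approxError (a + 2) b ≤ 4 * approxError (a + 2) (b + 1) ∧
      4 * approxError (a + 2) (b + 1) - 4 / (((a : ℝ) + 2) ^ 2 + ((b : ℝ) + 1) ^ 2) ^ 2 ≤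
        approxError (a + 3) (b + 1) + approxError (a + 1) (b + 1) + approxError (a + 2) (b + 2)
          + approxError (a + 2) b := by
  have hab' : (b : ℝ) ≤ a := by exact_mod_cast hab
  obtain ⟨h1, h2⟩ := arctan_discrete_laplacian_bounds (x := (a : ℝ) + 2) (y := (b : ℝ) + 1)
    (by linarith [(Nat.cast_nonneg b : (0 : ℝ) ≤ b)]) (by linarith)
  rw [show (a : ℝ) + 2 + 1 = a + 3 by ring, show (a : ℝ) + 2 - 1 = a + 1 by ring,
    show (b : ℝ) + 1 + 1 = b + 2 by ring, show (b : ℝ) + 1 - 1 = b by ring] at h1 h2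
  have hP := Pfirst_harmonic a b
  have hc0 : 0 < 2 / π := by positivity
  have hc1 : 2 / π ≤ 1 := by
    rw [div_le_one pi_pos]
    exact two_le_pi
  have h3 := mul_nonneg hc0.le h1
  have h4 := mul_le_mul hc1 h2 h1 zero_le_one
  simp only [approxError]
  push_cast
  constructor <;> linarith

lemma approxError_nonneg {a b : ℕ} (hab : b ≤ a) : 0 ≤ approxError a b :=
  nonneg_of_superharmonic_on_wedge (M := 1)
    (fun a b _ => (abs_le.1 (abs_approxError_le a b)).1) (fun a => (approxError_zero_right a).ge)
    (fun a => (approxError_self a).ge)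
    (fun _ _ h => (approxError_discrete_laplacian_bounds h).1) hab

lemma approxError_le_wedgeBarrier {a b : ℕ} (hab : b ≤ a) :
    approxError a b ≤ 4 * wedgeBarrier a b := by
  refine sub_nonneg.1 (nonneg_of_superharmonic_on_wedge (M := 1)
    (g := fun a b => 4 * wedgeBarrier a b - approxError a b) (fun a b h => ?_) (fun a => ?_)
    (fun a => ?_) (fun a b h => ?_) hab)
  · have h1 := wedgeBarrier_nonneg (Nat.cast_nonneg b) (Nat.cast_le (α := ℝ).2 h)
    have h2 := (abs_le.1 (abs_approxError_le a b)).2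
    linarith
  · simp [wedgeBarrier, approxError_zero_right]
  · simp [wedgeBarrier, approxError_self]
  · have h1 := (approxError_discrete_laplacian_bounds h).2
    have h' : (b : ℝ) ≤ a := by exact_mod_cast h
    have h2 := wedgeBarrier_discrete_laplacian_le (x := (a : ℝ) + 2) (y := (b : ℝ) + 1)
      (by linarith [(Nat.cast_nonneg b : (0 : ℝ) ≤ b)]) (by linarith)
    rw [show (a : ℝ) + 2 + 1 = a + 3 by ring, show (a : ℝ) + 2 - 1 = a + 1 by ring,
      show (b : ℝ) + 1 + 1 = b + 2 by ring, show (b : ℝ) + 1 - 1 = b by ring] at h2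
    rw [show (4 : ℝ) / (((a : ℝ) + 2) ^ 2 + ((b : ℝ) + 1) ^ 2) ^ 2
      = 4 * (1 / (((a : ℝ) + 2) ^ 2 + ((b : ℝ) + 1) ^ 2) ^ 2) by ring] at h1
    push_cast
    linarith

lemma abs_approxError_le_of_le {a b : ℕ} (hab : b ≤ a) :
    |approxError a b| ≤ 4 / ((a : ℝ) ^ 2 + (b : ℝ) ^ 2) := by
  rw [abs_of_nonneg (approxError_nonneg hab)]
  have h := wedgeBarrier_le a b
  calc approxError a b ≤ 4 * wedgeBarrier a b := approxError_le_wedgeBarrier hab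
    _ ≤ 4 * (1 / ((a : ℝ) ^ 2 + (b : ℝ) ^ 2)) := by gcongr
    _ = 4 / ((a : ℝ) ^ 2 + (b : ℝ) ^ 2) := by ring

theorem Pfirst_uniform_arctan_approx :
    ∃ C : ℝ, 0 < C ∧ ∀ a b : ℕ, 1 ≤ a → 1 ≤ b →
      |Pfirst a b - (2 / Real.pi) * Real.arctan ((b : ℝ) / (a : ℝ))|
        ≤ C / ((a : ℝ) ^ 2 + (b : ℝ) ^ 2) := by
  refine ⟨4, by norm_num, fun a b ha hb => ?_⟩
  change |approxError a b| ≤ _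
  rcases le_total b a with hab | hab
  · exact abs_approxError_le_of_le hab
  · obtain ⟨a, rfl⟩ := Nat.exists_eq_add_of_le' ha
    obtain ⟨b, rfl⟩ := Nat.exists_eq_add_of_le' hb
    rw [eq_neg_of_add_eq_zero_left (approxError_add_swap a b), abs_neg, add_comm (_ ^ 2)]
    exact abs_approxError_le_of_le hab
end

section
/- For every real v with 0 ≤ v < 1, the series ∑_{n=0}^∞ (v^{2n+1}/(2n+1)) · ∫_0^{π/2} tan φ · sin^{2n+1}(2φ) dφ converges and equals (π/2) · arcsin v. -/
open MeasureTheory Real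

theorem Ring.multichoose_one_half (n : ℕ) :
    Ring.multichoose (1 / 2 : ℝ) n =
      ∏ i ∈ Finset.range n, (2 * (i : ℝ) + 1) / (2 * i + 2) := by
  have h (m : ℕ) : (m.factorial : ℝ) * Ring.multichoose (1 / 2 : ℝ) m =
      (ascPochhammer ℝ m).eval (1 / 2) := by
    rw [← nsmul_eq_mul, Ring.factorial_nsmul_multichoose_eq_ascPochhammer,
      Polynomial.ascPochhammer_smeval_eq_eval]
  induction n with
  | zero => simp
  | succ n ih =>
    have h1 := h (n + 1)
    rw [ascPochhammer_succ_eval, ← h n, Nat.factorial_succ] at h1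
    rw [Finset.prod_range_succ, ← ih]
    have : (n.factorial : ℝ) ≠ 0 := by positivity
    push_cast at h1
    field_simp
    apply mul_left_cancel₀ this
    linear_combination 2 * h1

theorem hasSum_one_div_sqrt_one_sub_sq {x : ℝ} (hx : |x| < 1) :
    HasSum (fun n : ℕ => (∏ i ∈ Finset.range n, (2 * (i : ℝ) + 1) / (2 * i + 2)) * x ^ (2 * n))
      (1 / √(1 - x ^ 2)) := by
  have hx2 : x ^ 2 < 1 := (sq_lt_one_iff_abs_lt_one x).2 hx
  have hmem : x ^ 2 ∈ Metric.eball (0 : ℝ) 1 := by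
    rw [← ENNReal.ofReal_one, Metric.eball_ofReal]
    simpa using hx
  have h := (one_div_one_sub_rpow_hasFPowerSeriesOnBall_zero (1 / 2)).hasSum hmem
  rw [zero_add, ← sqrt_eq_rpow] at h
  convert! h using 2 with n
  rw [← Ring.multichoose_one_half, FormalMultilinearSeries.ofScalars_apply_eq, smul_eq_mul,
    Ring.multichoose_eq, pow_mul]

theorem hasSum_arcsin {x : ℝ} (hx : |x| < 1) :
    HasSum (fun n : ℕ => x ^ (2 * n + 1) / (2 * n + 1) *
      ∏ i ∈ Finset.range n, (2 * (i : ℝ) + 1) / (2 * i + 2)) (arcsin x) := by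
  have hlt {t : ℝ} (ht : t ∈ Set.uIcc 0 x) : |t| ≤ |x| := by
    simpa using Set.abs_sub_left_of_mem_uIcc ht
  have hint : ∫ t in (0 : ℝ)..x, 1 / √(1 - t ^ 2) = arcsin x := by
    rw [intervalIntegral.integral_eq_sub_of_hasDerivAt (f := arcsin), arcsin_zero, sub_zero]
    · intro t ht
      have := abs_lt.1 ((hlt ht).trans_lt hx)
      exact hasDerivAt_arcsin this.1.ne' this.2.ne
    · refine (ContinuousOn.div (by fun_prop) (by fun_prop) fun t ht => ?_).intervalIntegrable
      have := (sq_lt_one_iff_abs_lt_one t).2 ((hlt ht).trans_lt hx)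
      exact (sqrt_pos.2 (by linarith)).ne'
  rw [← hint]
  have key := intervalIntegral.hasSum_integral_of_dominated_convergence (μ := volume)
    (a := 0) (b := x) (f := fun t => 1 / √(1 - t ^ 2))
    (F := fun (n : ℕ) t => (∏ i ∈ Finset.range n, (2 * (i : ℝ) + 1) / (2 * i + 2)) * t ^ (2 * n))
    (fun n _ => (∏ i ∈ Finset.range n, (2 * (i : ℝ) + 1) / (2 * i + 2)) * |x| ^ (2 * n))
    (fun n => (by fun_prop : Continuous _).aestronglyMeasurable)
    (fun n => ae_of_all _ fun t ht => ?_)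
    (ae_of_all _ fun t _ => (hasSum_one_div_sqrt_one_sub_sq (by simpa using hx)).summable)
    intervalIntegrable_const
    (ae_of_all _ fun t ht => hasSum_one_div_sqrt_one_sub_sq
      ((hlt (Set.uIoc_subset_uIcc ht)).trans_lt hx))
  · convert! key using 2 with n
    simp [integral_pow]
    ring
  · have hpos : 0 ≤ ∏ i ∈ Finset.range n, (2 * (i : ℝ) + 1) / (2 * i + 2) :=
      Finset.prod_nonneg fun i _ => by positivity
    rw [norm_mul, norm_pow, norm_eq_abs, norm_eq_abs, abs_of_nonneg hpos]
    exact mul_le_mul_of_nonneg_left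
      (pow_le_pow_left₀ (abs_nonneg t) (hlt (Set.uIoc_subset_uIcc ht)) _) hpos

theorem integral_tan_mul_sin_two_mul_pow (n : ℕ) :
    ∫ φ in (0 : ℝ)..(π / 2), tan φ * sin (2 * φ) ^ (2 * n + 1) =
      π / 2 * ∏ i ∈ Finset.range n, (2 * (i : ℝ) + 1) / (2 * i + 2) := by
  have htan : ∫ φ in (0 : ℝ)..(π / 2), tan φ * sin (2 * φ) ^ (2 * n + 1) =
      ∫ φ in (0 : ℝ)..(π / 2), (sin (2 * φ) ^ (2 * n) - sin (2 * φ) ^ (2 * n) * cos (2 * φ)) := by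
    refine intervalIntegral.integral_congr_Ioo_of_le (by positivity) fun φ hφ => ?_
    have hcos : cos φ ≠ 0 :=
      (cos_pos_of_mem_Ioo ⟨by linarith [hφ.1, pi_pos], hφ.2⟩).ne'
    have hprod : tan φ * sin (2 * φ) = 1 - cos (2 * φ) := by
      rw [tan_eq_sin_div_cos, sin_two_mul, cos_two_mul']
      field_simp
      linear_combination sin_sq_add_cos_sq φ
    linear_combination sin (2 * φ) ^ (2 * n) * hprod
  have hcos : ∫ u in (0 : ℝ)..π, sin u ^ (2 * n) * cos u = 0 := by
    simpa using integral_sin_pow_mul_cos_pow_odd (a := 0) (b := π) (2 * n) 0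
  rw [htan, intervalIntegral.integral_comp_mul_left
      (fun u => sin u ^ (2 * n) - sin u ^ (2 * n) * cos u) two_ne_zero,
    mul_zero, mul_div_cancel₀ π two_ne_zero, intervalIntegral.integral_sub
      ((by fun_prop : Continuous _).intervalIntegrable _ _)
      ((by fun_prop : Continuous _).intervalIntegrable _ _),
    hcos, integral_sin_pow_even, smul_eq_mul]
  ring

theorem series_tan_sin_pow_eq_arcsin (v : ℝ) (hv0 : 0 ≤ v) (hv1 : v < 1) :
    HasSum
      (fun n : ℕ => v ^ (2 * n + 1) / (2 * n + 1) *
        ∫ φ in (0 : ℝ)..(Real.pi / 2), Real.tan φ * Real.sin (2 * φ) ^ (2 * n + 1))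
      (Real.pi / 2 * Real.arcsin v) := by
  simp only [integral_tan_mul_sin_two_mul_pow, mul_left_comm _ (π / 2)]
  exact (hasSum_arcsin (by rwa [abs_of_nonneg hv0])).mul_left _
end

section
/- For all real numbers a > 0, b > 0, c > 0, the double integral ∫_0^∞ ∫_0^∞ [sin(cθ)/θ] · [sin(bσ)/σ] · [σ²/(θ² + σ²)] · e^{−a√(θ² + σ²)} dθ dσ converges and equals (1/4) ∫_0^{π/2} tan φ · ln[(a² + (c cos φ + b sin φ)²)/(a² + (c cos φ − b sin φ)²)] dφ. -/
open MeasureTheory Real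

lemma abs_sin_mul_div_le (c x : ℝ) (hc : 0 ≤ c) (hx : 0 < x) : |Real.sin (c * x) / x| ≤ c := by
  rw [abs_div, abs_of_pos hx, div_le_iff₀ hx]
  calc |Real.sin (c * x)| ≤ |c * x| := Real.abs_sin_le_abs
    _ = c * x := abs_of_nonneg (by positivity)

lemma integrableOn_mul_exp_neg_mul {a C : ℝ} (ha : 0 < a) {f : ℝ → ℝ} (hf : Measurable f)
    (hb : ∀ x ∈ Set.Ioi (0 : ℝ), |f x| ≤ C) :
    IntegrableOn (fun x => f x * Real.exp (-a * x)) (Set.Ioi 0) := by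
  refine Integrable.mono' ((exp_neg_integrableOn_Ioi 0 ha).const_mul C)
    (by fun_prop) ?_
  filter_upwards [ae_restrict_mem measurableSet_Ioi] with x hx
  rw [Real.norm_eq_abs, abs_mul, abs_of_pos (Real.exp_pos _)]
  exact mul_le_mul_of_nonneg_right (hb x hx) (Real.exp_pos _).le

lemma integral_sin_mul_exp_neg_mul {a : ℝ} (ha : 0 < a) (w : ℝ) :
    ∫ x in Set.Ioi (0 : ℝ), Real.sin (w * x) * Real.exp (-a * x) = w / (a ^ 2 + w ^ 2) := by
  have hpos : 0 < a ^ 2 + w ^ 2 := by positivity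
  have hderiv : ∀ x ∈ Set.Ici (0 : ℝ), HasDerivAt
      (fun x => -((a * Real.sin (w * x) + w * Real.cos (w * x)) / (a ^ 2 + w ^ 2)) *
        Real.exp (-a * x)) (Real.sin (w * x) * Real.exp (-a * x)) x := by
    intro x _
    have hw : HasDerivAt (fun x : ℝ => w * x) w x := by
      simpa using (hasDerivAt_id x).const_mul w
    have he : HasDerivAt (fun x : ℝ => -a * x) (-a) x := by
      simpa using (hasDerivAt_id x).const_mul (-a)
    refine ((((hw.sin.const_mul a).add (hw.cos.const_mul w)).div_const (a ^ 2 + w ^ 2)).neg.mul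
      he.exp).congr_deriv ?_
    simp only [Pi.add_apply, Pi.neg_apply]
    field_simp
    ring
  have hexp : Filter.Tendsto (fun x : ℝ => Real.exp (-a * x)) Filter.atTop (nhds 0) :=
    Real.tendsto_exp_atBot.comp (Filter.tendsto_id.const_mul_atTop_of_neg (neg_neg_iff_pos.2 ha))
  have hlim := bdd_le_mul_tendsto_zero' ((a + |w|) / (a ^ 2 + w ^ 2))
    (f := fun x => -((a * Real.sin (w * x) + w * Real.cos (w * x)) / (a ^ 2 + w ^ 2)))
    (Filter.Eventually.of_forall fun x => by
      rw [abs_neg, abs_div, abs_of_pos hpos]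
      gcongr
      refine (abs_add_le _ _).trans ?_
      rw [abs_mul, abs_mul, abs_of_pos ha]
      nlinarith [Real.abs_sin_le_one (w * x), Real.abs_cos_le_one (w * x), abs_nonneg w]) hexp
  rw [integral_Ioi_of_hasDerivAt_of_tendsto' hderiv
    (integrableOn_mul_exp_neg_mul ha (C := 1) (by fun_prop) fun x _ => Real.abs_sin_le_one _) hlim]
  simp

lemma integral_sin_mul_sin_div_mul_exp {a : ℝ} (ha : 0 < a) (u v : ℝ) :
    ∫ x in Set.Ioi (0 : ℝ), Real.sin (u * x) * Real.sin (v * x) / x * Real.exp (-a * x) =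
      1 / 4 * Real.log ((a ^ 2 + (u + v) ^ 2) / (a ^ 2 + (u - v) ^ 2)) := by
  have h1 (v : ℝ) : 0 < a ^ 2 + (u + v) ^ 2 := by positivity
  have h2 (v : ℝ) : 0 < a ^ 2 + (u - v) ^ 2 := by positivity
  have hL (v : ℝ) : HasDerivAt (fun v => ∫ x in Set.Ioi (0 : ℝ),
      Real.sin (u * x) * Real.sin (v * x) / x * Real.exp (-a * x))
      (∫ x in Set.Ioi (0 : ℝ), Real.sin (u * x) * Real.cos (v * x) * Real.exp (-a * x)) v := by
    refine (hasDerivAt_integral_of_dominated_loc_of_deriv_le (s := Set.univ)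
      (F' := fun v x => Real.sin (u * x) * Real.cos (v * x) * Real.exp (-a * x))
      (bound := fun x => Real.exp (-a * x)) Filter.univ_mem
      (Filter.Eventually.of_forall fun v => by fun_prop) ?_ (by fun_prop) ?_
      (exp_neg_integrableOn_Ioi 0 ha) ?_).2
    · refine integrableOn_mul_exp_neg_mul ha (C := |v|) (by fun_prop) fun x hx => ?_
      have hx : 0 < x := hx
      rw [abs_div, abs_mul, abs_of_pos hx, div_le_iff₀ hx]
      have := Real.abs_sin_le_abs (x := v * x)
      rw [abs_mul, abs_of_pos hx] at this
      nlinarith [Real.abs_sin_le_one (u * x), abs_nonneg (Real.sin (v * x))]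
    · refine Filter.Eventually.of_forall fun x v _ => ?_
      rw [Real.norm_eq_abs, abs_mul, abs_mul, abs_of_pos (Real.exp_pos _)]
      refine mul_le_of_le_one_left (Real.exp_pos _).le ?_
      exact mul_le_one₀ (Real.abs_sin_le_one _) (abs_nonneg _) (Real.abs_cos_le_one _)
    · filter_upwards [ae_restrict_mem measurableSet_Ioi] with x hx v _
      have hx : x ≠ 0 := ne_of_gt hx
      have hv : HasDerivAt (fun v : ℝ => v * x) x v := by
        simpa using (hasDerivAt_id v).mul_const x
      refine (((hv.sin.const_mul (Real.sin (u * x))).div_const x).mul_const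
        (Real.exp (-a * x))).congr_deriv ?_
      field_simp
  have hval (v : ℝ) :
      ∫ x in Set.Ioi (0 : ℝ), Real.sin (u * x) * Real.cos (v * x) * Real.exp (-a * x) =
        1 / 2 * ((u + v) / (a ^ 2 + (u + v) ^ 2) + (u - v) / (a ^ 2 + (u - v) ^ 2)) := by
    rw [← integral_sin_mul_exp_neg_mul ha (u + v), ← integral_sin_mul_exp_neg_mul ha (u - v),
      ← integral_add, ← integral_const_mul]
    · refine integral_congr_ae (Filter.Eventually.of_forall fun x => ?_)
      simp only [add_mul, sub_mul, Real.sin_add, Real.sin_sub]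
      ring
    · exact integrableOn_mul_exp_neg_mul ha (C := 1) (by fun_prop)
        fun x _ => Real.abs_sin_le_one _
    · exact integrableOn_mul_exp_neg_mul ha (C := 1) (by fun_prop)
        fun x _ => Real.abs_sin_le_one _
  have hR (v : ℝ) : HasDerivAt
      (fun v => 1 / 4 * (Real.log (a ^ 2 + (u + v) ^ 2) - Real.log (a ^ 2 + (u - v) ^ 2)))
      (1 / 2 * ((u + v) / (a ^ 2 + (u + v) ^ 2) + (u - v) / (a ^ 2 + (u - v) ^ 2))) v := by
    have hp := (((((hasDerivAt_id v).const_add u).pow 2).const_add (a ^ 2)).log (h1 v).ne')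
    have hm := (((((hasDerivAt_id v).const_sub u).pow 2).const_add (a ^ 2)).log (h2 v).ne')
    refine ((hp.sub hm).const_mul (1 / 4)).congr_deriv ?_
    have := (h1 v).ne'
    have := (h2 v).ne'
    simp
    field_simp
    ring
  have hconst := is_const_of_deriv_eq_zero
    (fun v => ((hL v).sub (hR v)).differentiableAt)
    (fun v => by rw [((hL v).sub (hR v)).deriv, hval, sub_self]) v 0
  rw [Real.log_div (h1 v).ne' (h2 v).ne']
  simpa [sub_eq_zero] using hconst

lemma setIntegral_quadrant_eq_polar (f : ℝ × ℝ → ℝ) :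
    ∫ q in Set.Ioi (0 : ℝ) ×ˢ Set.Ioi (0 : ℝ), f q =
      ∫ p in Set.Ioi (0 : ℝ) ×ˢ Set.Ioo (0 : ℝ) (π / 2),
        p.1 * f (p.1 * Real.cos p.2, p.1 * Real.sin p.2) := by
  rw [← integral_indicator (measurableSet_Ioi.prod measurableSet_Ioi),
    ← integral_comp_polarCoord_symm, ← integral_indicator polarCoord.open_target.measurableSet,
    ← integral_indicator (measurableSet_Ioi.prod measurableSet_Ioo)]
  congr 1
  ext ⟨r, φ⟩
  have hpi := Real.pi_pos
  have key (hr : 0 < r) (h1 : -π < φ) (h2 : φ < π) :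
      (0 < r * Real.cos φ ∧ 0 < r * Real.sin φ) ↔ (0 < φ ∧ φ < π / 2) := by
    rw [mul_pos_iff_of_pos_left hr, mul_pos_iff_of_pos_left hr]
    constructor
    · rintro ⟨hc, hs⟩
      refine ⟨?_, ?_⟩
      · by_contra! h
        exact absurd hs (not_lt.2 (Real.sin_nonpos_of_nonpos_of_neg_pi_le h h1.le))
      · by_contra! h
        exact absurd hc (not_lt.2 (Real.cos_nonpos_of_pi_div_two_le_of_le h (by linarith)))
    · rintro ⟨h3, h4⟩
      exact ⟨Real.cos_pos_of_mem_Ioo ⟨by linarith, h4⟩, Real.sin_pos_of_pos_of_lt_pi h3 h2⟩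
  simp only [Set.indicator, Set.mem_prod, Set.mem_Ioi, Set.mem_Ioo, polarCoord_target,
    polarCoord_symm_apply,
    smul_eq_mul]
  by_cases hr : 0 < r
  · by_cases hφ : -π < φ ∧ φ < π
    · simp only [hr, hφ.1, hφ.2, key hr hφ.1 hφ.2, true_and, and_self, if_true, mul_ite, mul_zero]
    · have : ¬(0 < φ ∧ φ < π / 2) := fun h => hφ ⟨by linarith [h.1], by linarith [h.2]⟩
      simp [hφ, this]
  · simp [hr]

lemma integrableOn_quadrant {a b c : ℝ} (ha : 0 < a) (hb : 0 < b) (hc : 0 < c) :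
    IntegrableOn
      (fun q : ℝ × ℝ =>
        Real.sin (c * q.1) / q.1 * (Real.sin (b * q.2) / q.2) *
          (q.2 ^ 2 / (q.1 ^ 2 + q.2 ^ 2)) * Real.exp (-a * Real.sqrt (q.1 ^ 2 + q.2 ^ 2)))
      (Set.Ioi 0 ×ˢ Set.Ioi 0) := by
  have he := exp_neg_integrableOn_Ioi 0 (half_pos ha)
  have hprod := (he.mul_prod he).const_mul (c * b)
  rw [Measure.prod_restrict] at hprod
  refine Integrable.mono' hprod (by fun_prop) ?_
  filter_upwards [ae_restrict_mem (measurableSet_Ioi.prod measurableSet_Ioi)] with q hq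
  have h1 : 0 < q.1 := hq.1
  have h2 : 0 < q.2 := hq.2
  have hfrac : |q.2 ^ 2 / (q.1 ^ 2 + q.2 ^ 2)| ≤ 1 := by
    rw [abs_of_nonneg (by positivity), div_le_one (by positivity)]
    nlinarith
  have hsqrt : (q.1 + q.2) / 2 ≤ Real.sqrt (q.1 ^ 2 + q.2 ^ 2) :=
    Real.le_sqrt_of_sq_le (by nlinarith [sq_nonneg (q.1 - q.2)])
  rw [Real.norm_eq_abs, abs_mul, abs_mul, abs_mul, abs_of_pos (Real.exp_pos _), ← Real.exp_add,
    ← mul_one (c * b)]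
  gcongr
  · exact abs_sin_mul_div_le c _ hc.le h1
  · exact abs_sin_mul_div_le b _ hb.le h2
  · nlinarith

lemma polar_integrand_eq {a b c r φ : ℝ} (hr : 0 < r) (hφ : φ ∈ Set.Ioo 0 (π / 2)) :
    r * (Real.sin (c * (r * Real.cos φ)) / (r * Real.cos φ) *
      (Real.sin (b * (r * Real.sin φ)) / (r * Real.sin φ)) *
      ((r * Real.sin φ) ^ 2 / ((r * Real.cos φ) ^ 2 + (r * Real.sin φ) ^ 2)) *
      Real.exp (-a * Real.sqrt ((r * Real.cos φ) ^ 2 + (r * Real.sin φ) ^ 2))) =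
    Real.tan φ * (Real.sin (c * Real.cos φ * r) * Real.sin (b * Real.sin φ * r) / r *
      Real.exp (-a * r)) := by
  have hc : 0 < Real.cos φ := Real.cos_pos_of_mem_Ioo ⟨by linarith [hφ.1, Real.pi_pos], hφ.2⟩
  have hs : 0 < Real.sin φ :=
    Real.sin_pos_of_pos_of_lt_pi hφ.1 (by linarith [hφ.2, Real.pi_pos])
  have hsq : (r * Real.cos φ) ^ 2 + (r * Real.sin φ) ^ 2 = r ^ 2 := by
    linear_combination r ^ 2 * Real.cos_sq_add_sin_sq φ
  rw [hsq, Real.sqrt_sq hr.le, Real.tan_eq_sin_div_cos,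
    show c * (r * Real.cos φ) = c * Real.cos φ * r by ring,
    show b * (r * Real.sin φ) = b * Real.sin φ * r by ring]
  field_simp

lemma integrableOn_polar {a b c : ℝ} (ha : 0 < a) (hb : 0 < b) (hc : 0 < c) :
    IntegrableOn
      (fun p : ℝ × ℝ => Real.tan p.2 * (Real.sin (c * Real.cos p.2 * p.1) *
        Real.sin (b * Real.sin p.2 * p.1) / p.1 * Real.exp (-a * p.1)))
      (Set.Ioi 0 ×ˢ Set.Ioo 0 (π / 2)) := by
  have he : IntegrableOn (fun x : ℝ => x * Real.exp (-a * x)) (Set.Ioi 0) := by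
    simpa using integrableOn_rpow_mul_exp_neg_mul_rpow (p := 1) (s := 1) (b := a)
      (by norm_num) one_pos ha
  have hone : IntegrableOn (fun _ : ℝ => c * b) (Set.Ioo 0 (π / 2)) :=
    integrableOn_const (by simp)
  have hprod := he.mul_prod hone
  rw [Measure.prod_restrict] at hprod
  have htan : Measurable Real.tan := by
    rw [funext Real.tan_eq_sin_div_cos]; fun_prop
  refine Integrable.mono' hprod (by fun_prop) ?_
  filter_upwards [ae_restrict_mem (measurableSet_Ioi.prod measurableSet_Ioo)] with p hp
  obtain ⟨r, φ⟩ := p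
  have hr : 0 < r := hp.1
  have hφ : φ ∈ Set.Ioo 0 (π / 2) := hp.2
  have hcos : 0 < Real.cos φ := Real.cos_pos_of_mem_Ioo ⟨by linarith [hφ.1, Real.pi_pos], hφ.2⟩
  have hsin : 0 < Real.sin φ :=
    Real.sin_pos_of_pos_of_lt_pi hφ.1 (by linarith [hφ.2, Real.pi_pos])
  have h1 : |Real.sin (c * Real.cos φ * r)| ≤ c * Real.cos φ * r :=
    Real.abs_sin_le_abs.trans_eq (abs_of_pos (by positivity))
  have h2 : |Real.sin (b * Real.sin φ * r)| ≤ b * Real.sin φ * r :=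
    Real.abs_sin_le_abs.trans_eq (abs_of_pos (by positivity))
  simp only [Real.norm_eq_abs, abs_mul, abs_div, Real.tan_eq_sin_div_cos, abs_of_pos hr,
    abs_of_pos hcos, abs_of_pos hsin, abs_of_pos (Real.exp_pos _)]
  calc Real.sin φ / Real.cos φ * (|Real.sin (c * Real.cos φ * r)| *
        |Real.sin (b * Real.sin φ * r)| / r * Real.exp (-a * r))
      ≤ Real.sin φ / Real.cos φ * (c * Real.cos φ * r * (b * Real.sin φ * r) / r *
        Real.exp (-a * r)) := by gcongr
    _ = r * Real.exp (-a * r) * (c * b) * Real.sin φ ^ 2 := by field_simp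
    _ ≤ r * Real.exp (-a * r) * (c * b) :=
      mul_le_of_le_one_right (by positivity) (Real.sin_sq_le_one φ)

theorem double_integral_polar_identity (a b c : ℝ) (ha : 0 < a) (hb : 0 < b) (hc : 0 < c) :
    IntegrableOn
      (fun q : ℝ × ℝ =>
        Real.sin (c * q.1) / q.1 * (Real.sin (b * q.2) / q.2) *
          (q.2 ^ 2 / (q.1 ^ 2 + q.2 ^ 2)) * Real.exp (-a * Real.sqrt (q.1 ^ 2 + q.2 ^ 2)))
      (Set.Ioi 0 ×ˢ Set.Ioi 0) ∧
    (∫ σ in Set.Ioi (0 : ℝ), ∫ θ in Set.Ioi (0 : ℝ),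
        Real.sin (c * θ) / θ * (Real.sin (b * σ) / σ) *
          (σ ^ 2 / (θ ^ 2 + σ ^ 2)) * Real.exp (-a * Real.sqrt (θ ^ 2 + σ ^ 2)))
      = (1 / 4) * ∫ φ in (0 : ℝ)..(Real.pi / 2),
          Real.tan φ *
            Real.log ((a ^ 2 + (c * Real.cos φ + b * Real.sin φ) ^ 2) /
              (a ^ 2 + (c * Real.cos φ - b * Real.sin φ) ^ 2)) := by
  have hint := integrableOn_quadrant ha hb hc
  refine ⟨hint, ?_⟩
  have hpol := integrableOn_polar ha hb hc
  have hfub := integral_prod_symm _ (by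
    rwa [IntegrableOn, Measure.volume_eq_prod, ← Measure.prod_restrict] at hint)
  have hfub' := integral_prod_symm _ (by
    rwa [IntegrableOn, Measure.volume_eq_prod, ← Measure.prod_restrict] at hpol)
  rw [Measure.prod_restrict, ← Measure.volume_eq_prod] at hfub hfub'
  rw [← hfub, setIntegral_quadrant_eq_polar,
    setIntegral_congr_fun (measurableSet_Ioi.prod measurableSet_Ioo)
      (fun p hp => polar_integrand_eq hp.1 hp.2), hfub',
    intervalIntegral.integral_of_le (by positivity), integral_Ioc_eq_integral_Ioo,
    ← integral_const_mul]
  refine integral_congr_ae (Filter.Eventually.of_forall fun φ => ?_)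
  simp only
  rw [integral_const_mul, integral_sin_mul_sin_div_mul_exp ha]
  ring
end
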